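/- Kato–Kuroda–Birman consequence: let A and B be self-adjoint operators on a Hilbert space H such that (A+i)^{−1} − (B+i)^{−1} is a finite-rank operator. Then for every u₀ ∈ H there exists u₊ ∈ H such that ‖e^{−itB} P_{ac}(B) u₀ − e^{−itA} u₊‖_H → 0 as t → ∞, where P_{ac}(B) is the projection onto the absolutely continuous subspace of B. -/

import Mathlib

open MeasureTheory Complex Set Filter
open scoped ENNReal Topology InnerProductSpace

noncomputable section

/-- Data of a self-adjoint operator `A` on a Hilbert space, encoded by its strongly
continuous one-parameter unitary group `U t = e^{itA}` (Stone's theorem) together with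
the orthogonal projection `Pac` onto its absolutely continuous spectral subspace,
characterized by absolute continuity (w.r.t. Lebesgue measure) of the spectral measure
`μ_x`, i.e. existence of an integrable density `h` whose Fourier transform is
`t ↦ ⟪e^{itA}x, x⟫`. -/
structure SelfAdjointDynamics (H : Type*) [NormedAddCommGroup H]
    [InnerProductSpace ℂ H] [CompleteSpace H] where
  U : ℝ → H ≃ₗᵢ[ℂ] H
  U_zero : U 0 = LinearIsometryEquiv.refl ℂ H
  U_add : ∀ s t : ℝ, U (s + t) = (U s).trans (U t)
  U_cont : ∀ x : H, Continuous fun t : ℝ => U t x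
  Pac : H →L[ℂ] H
  Pac_idem : ∀ x : H, Pac (Pac x) = Pac x
  Pac_symm : ∀ x y : H, ⟪Pac x, y⟫_ℂ = ⟪x, Pac y⟫_ℂ
  Pac_mem : ∀ x : H, Pac x = x ↔
    ∃ h : ℝ → ℝ, Integrable h ∧
      ∀ t : ℝ, ⟪U t x, x⟫_ℂ =
        ∫ l : ℝ, Complex.exp (Complex.I * (t : ℂ) * (l : ℂ)) * (h l : ℂ)

/-- The resolvent `(A + i)⁻¹ = -i ∫₀^∞ e^{-s} e^{isA} ds` of the generator of the
unitary group. -/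
def SelfAdjointDynamics.resolvent {H : Type*} [NormedAddCommGroup H]
    [InnerProductSpace ℂ H] [CompleteSpace H] (G : SelfAdjointDynamics H) (x : H) : H :=
  (-Complex.I) • ∫ s in Set.Ioi (0:ℝ), Real.exp (-s) • G.U s x

namespace KKB
section

variable {H : Type*} [NormedAddCommGroup H] [InnerProductSpace ℂ H] [CompleteSpace H]

lemma U_add_apply (G : SelfAdjointDynamics H) (s t : ℝ) (x : H) :
    G.U (s + t) x = G.U t (G.U s x) := by
  rw [G.U_add]; rfl

lemma U_comm (G : SelfAdjointDynamics H) (s t : ℝ) (x : H) :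
    G.U s (G.U t x) = G.U t (G.U s x) := by
  rw [← U_add_apply, ← U_add_apply, add_comm]

lemma U_zero_apply (G : SelfAdjointDynamics H) (x : H) : G.U 0 x = x := by
  rw [G.U_zero]; rfl

lemma U_neg_cancel (G : SelfAdjointDynamics H) (t : ℝ) (x : H) : G.U (-t) (G.U t x) = x := by
  rw [← U_add_apply, add_neg_cancel, U_zero_apply]

lemma U_cancel_neg (G : SelfAdjointDynamics H) (t : ℝ) (x : H) : G.U t (G.U (-t) x) = x := by
  rw [← U_add_apply, neg_add_cancel, U_zero_apply]

lemma inner_U_left (G : SelfAdjointDynamics H) (t : ℝ) (x y : H) :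
    ⟪G.U t x, y⟫_ℂ = ⟪x, G.U (-t) y⟫_ℂ := by
  rw [← (G.U t).inner_map_map x (G.U (-t) y), U_cancel_neg]

lemma inner_U_right (G : SelfAdjointDynamics H) (t : ℝ) (x y : H) :
    ⟪x, G.U t y⟫_ℂ = ⟪G.U (-t) x, y⟫_ℂ := by
  rw [inner_U_left, neg_neg]

lemma integrable_exp_U (G : SelfAdjointDynamics H) (x : H) (a : ℝ) :
    IntegrableOn (fun s : ℝ => Real.exp (-s) • G.U s x) (Ioi a) := by
  have h1 : IntegrableOn (fun s : ℝ => Real.exp (-s) * ‖x‖) (Ioi a) :=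
    (integrableOn_exp_neg_Ioi a).mul_const _
  refine Integrable.mono' h1 ?_ ?_
  · exact ((by fun_prop : Continuous fun s : ℝ => Real.exp (-s)).smul
      (G.U_cont x)).aestronglyMeasurable
  · refine Eventually.of_forall fun s => ?_
    rw [norm_smul, LinearIsometryEquiv.norm_map, Real.norm_eq_abs, abs_of_pos (Real.exp_pos _)]

/-- The resolvent as a bounded operator. -/
def RC (G : SelfAdjointDynamics H) : H →L[ℂ] H :=
  LinearMap.mkContinuous
    { toFun := G.resolvent
      map_add' := by
        intro x y
        simp only [SelfAdjointDynamics.resolvent, map_add, smul_add]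
        rw [integral_add (integrable_exp_U G x 0) (integrable_exp_U G y 0), smul_add]
      map_smul' := by
        intro c x
        simp only [SelfAdjointDynamics.resolvent, map_smul, RingHom.id_apply]
        have e : (fun s : ℝ => Real.exp (-s) • c • G.U s x)
            = fun s : ℝ => c • Real.exp (-s) • G.U s x := funext fun s => smul_comm _ _ _
        rw [e, integral_smul, smul_comm] }
    1 (by
      intro x
      simp only [LinearMap.coe_mk, AddHom.coe_mk, SelfAdjointDynamics.resolvent, norm_smul,
        norm_neg, norm_I, one_mul]
      have h1 : IntegrableOn (fun s : ℝ => Real.exp (-s) * ‖x‖) (Ioi 0) :=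
        (integrableOn_exp_neg_Ioi 0).mul_const _
      calc _ ≤ ∫ s in Ioi (0:ℝ), Real.exp (-s) * ‖x‖ := by
            refine norm_integral_le_of_norm_le h1 (Eventually.of_forall fun s => ?_)
            rw [norm_smul, LinearIsometryEquiv.norm_map, Real.norm_eq_abs,
              abs_of_pos (Real.exp_pos _)]
        _ = ‖x‖ := by
            rw [integral_mul_const, integral_exp_neg_Ioi_zero, one_mul])

lemma RC_apply (G : SelfAdjointDynamics H) (x : H) : RC G x = G.resolvent x := rfl

lemma U_RC (G : SelfAdjointDynamics H) (t : ℝ) (x : H) :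
    G.U t (RC G x) = RC G (G.U t x) := by
  simp only [RC_apply, SelfAdjointDynamics.resolvent, map_smul]
  congr 1
  have := (G.U t).toContinuousLinearEquiv.toContinuousLinearMap.integral_comp_comm
    (integrable_exp_U G x 0)
  simp only [ContinuousLinearEquiv.coe_coe, LinearIsometryEquiv.coe_toContinuousLinearEquiv] at this
  rw [← this]
  congr 1
  ext s
  rw [← U_comm G t s, ← Complex.coe_smul, ← Complex.coe_smul, map_smul]

lemma U_RC_eq (G : SelfAdjointDynamics H) (t : ℝ) (x : H) :
    G.U t (RC G x) = (-Complex.I) • (Real.exp t •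
      ((∫ s in Ioi (0:ℝ), Real.exp (-s) • G.U s x) - ∫ s in (0:ℝ)..t, Real.exp (-s) • G.U s x)) := by
  rw [U_RC, RC_apply, SelfAdjointDynamics.resolvent]
  congr 1
  have h2 := intervalIntegral.integral_Ioi_sub_Ioi' (integrable_exp_U G x 0) (integrable_exp_U G x t)
  rw [← h2, sub_sub_cancel, ← integral_smul]
  have h3 := (measurePreserving_add_right volume t).setIntegral_preimage_emb
    (MeasurableEquiv.addRight t).measurableEmbedding
    (fun a => Real.exp t • Real.exp (-a) • G.U a x) (Ioi t)
  rw [← h3]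
  have h4 : (fun a : ℝ => a + t) ⁻¹' Ioi t = Ioi 0 := by ext a; simp
  rw [h4]
  refine integral_congr_ae (Eventually.of_forall fun s => ?_)
  simp only
  rw [smul_smul, ← Real.exp_add, U_add_apply, U_comm]
  congr 2
  ring

lemma hasDerivAt_U_RC (G : SelfAdjointDynamics H) (t : ℝ) (x : H) :
    HasDerivAt (fun τ : ℝ => G.U τ (RC G x)) (G.U t (RC G x + Complex.I • x)) t := by
  have hc : Continuous fun s : ℝ => Real.exp (-s) • G.U s x :=
    (by fun_prop : Continuous fun s : ℝ => Real.exp (-s)).smul (G.U_cont x)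
  have h1 := intervalIntegral.integral_hasDerivAt_right (hc.intervalIntegrable 0 t)
    (hc.stronglyMeasurableAtFilter _ _) hc.continuousAt
  have h2 := (((Real.hasDerivAt_exp t).smul
    (h1.const_sub (∫ s in Ioi (0:ℝ), Real.exp (-s) • G.U s x))).const_smul (-Complex.I))
  simp_rw [U_RC_eq]
  refine h2.congr_deriv ?_
  rw [map_add, U_RC_eq, smul_add, add_comm, map_smul]
  congr 1
  rw [smul_neg, smul_smul, ← Real.exp_add]
  simp

end
end KKB

namespace KKB
section

variable {H : Type*} [NormedAddCommGroup H] [InnerProductSpace ℂ H] [CompleteSpace H]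

/-- Vectors whose matrix coefficients along the (backwards) flow are square integrable. -/
def Nice (G : SelfAdjointDynamics H) (u : H) : Prop :=
  ∃ C : ℝ, 0 ≤ C ∧ ∀ v : H, Integrable (fun τ : ℝ => ‖⟪v, G.U (-τ) u⟫_ℂ‖ ^ 2) ∧
    ∫ τ : ℝ, ‖⟪v, G.U (-τ) u⟫_ℂ‖ ^ 2 ≤ C * ‖v‖ ^ 2

lemma Nice.map {G : SelfAdjointDynamics H} {u : H} (hu : Nice G u) (T : H →L[ℂ] H)
    (hT : ∀ t x, G.U t (T x) = T (G.U t x)) : Nice G (T u) := by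
  obtain ⟨C, hC, h⟩ := hu
  refine ⟨C * ‖T‖ ^ 2, by positivity, fun v => ?_⟩
  have e : ∀ τ : ℝ, ⟪v, G.U (-τ) (T u)⟫_ℂ = ⟪T.adjoint v, G.U (-τ) u⟫_ℂ := fun τ => by
    rw [hT, ContinuousLinearMap.adjoint_inner_left]
  simp_rw [e]
  refine ⟨(h _).1, (h _).2.trans ?_⟩
  have : ‖T.adjoint v‖ ≤ ‖T‖ * ‖v‖ := by
    simpa using T.adjoint.le_opNorm v
  calc C * ‖T.adjoint v‖ ^ 2 ≤ C * (‖T‖ * ‖v‖) ^ 2 := by gcongr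
    _ = _ := by ring

lemma Nice.U {G : SelfAdjointDynamics H} {u : H} (hu : Nice G u) (s : ℝ) : Nice G (G.U s u) :=
  hu.map (G.U s).toContinuousLinearEquiv.toContinuousLinearMap fun t x => by
    simpa using U_comm G t s x

lemma Nice.RC {G : SelfAdjointDynamics H} {u : H} (hu : Nice G u) : Nice G (RC G u) :=
  hu.map (KKB.RC G) fun t x => U_RC G t x

lemma hasDerivAt_U_neg_RC (G : SelfAdjointDynamics H) (t : ℝ) (x : H) :
    HasDerivAt (fun τ : ℝ => G.U (-τ) (RC G x)) (-(G.U (-t) (RC G x + Complex.I • x))) t := by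
  have := (hasDerivAt_U_RC G (-t) x).scomp t (hasDerivAt_neg t)
  simpa only [Function.comp_def, neg_smul, one_smul] using this

lemma continuous_U_neg (G : SelfAdjointDynamics H) (x : H) : Continuous fun τ : ℝ => G.U (-τ) x :=
  (G.U_cont x).comp continuous_neg

lemma Nice.tendsto {G : SelfAdjointDynamics H} {u : H} (hu : Nice G u) (v : H) :
    Tendsto (fun τ : ℝ => ⟪v, G.U (-τ) (KKB.RC G u)⟫_ℂ) atTop (𝓝 0) := by
  obtain ⟨C, hC, h⟩ := hu.RC
  have hu2 : Nice G (KKB.RC G u + Complex.I • u) := by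
    refine hu.map (KKB.RC G + Complex.I • ContinuousLinearMap.id ℂ H) fun t x => ?_
    simp [U_RC]
  obtain ⟨C', hC', h'⟩ := hu2
  set q : ℝ → ℂ := fun τ => ⟪v, G.U (-τ) (KKB.RC G u)⟫_ℂ with hq
  set q' : ℝ → ℂ := fun τ => -⟪v, G.U (-τ) (KKB.RC G u + Complex.I • u)⟫_ℂ with hq'
  have hd : ∀ τ, HasDerivAt q (q' τ) τ := fun τ => by
    have := (hasDerivAt_const τ v).inner ℂ (hasDerivAt_U_neg_RC G τ u)
    simpa only [hq, hq', inner_neg_right, inner_zero_left, add_zero] using this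
  have hcq : Continuous q := continuous_const.inner (continuous_U_neg G _)
  have hcq' : Continuous q' := (continuous_const.inner (continuous_U_neg G _)).neg
  have hd2 : ∀ τ, HasDerivAt (fun τ => ⟪q τ, q τ⟫_ℂ) (⟪q τ, q' τ⟫_ℂ + ⟪q' τ, q τ⟫_ℂ) τ :=
    fun τ => (hd τ).inner ℂ (hd τ)
  have i1 : Integrable (fun τ => ‖q τ‖ ^ 2) := (h v).1
  have i2 : Integrable (fun τ => ‖q' τ‖ ^ 2) := by simpa only [hq', norm_neg] using (h' v).1
  have lim := tendsto_zero_of_hasDerivAt_of_integrableOn_Ioi (a := 0)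
    (f := fun τ => ⟪q τ, q τ⟫_ℂ) (fun τ _ => hd2 τ)
    (by
      refine Integrable.integrableOn ?_
      refine Integrable.mono' (i1.add i2) (by fun_prop) (Eventually.of_forall fun τ => ?_)
      have := norm_inner_le_norm (𝕜 := ℂ) (q τ) (q' τ)
      have := norm_inner_le_norm (𝕜 := ℂ) (q' τ) (q τ)
      refine (norm_add_le _ _).trans ?_
      simp only [Pi.add_apply]
      nlinarith [sq_nonneg (‖q τ‖ - ‖q' τ‖)])
    (by
      refine Integrable.integrableOn ?_
      refine Integrable.mono' i1 (by fun_prop) (Eventually.of_forall fun τ => ?_)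
      have := norm_inner_le_norm (𝕜 := ℂ) (q τ) (q τ)
      nlinarith)
  have lim2 := lim.norm
  have e : ∀ τ, ‖⟪q τ, q τ⟫_ℂ‖ = ‖q τ‖ ^ 2 := fun τ => by
    rw [inner_self_eq_norm_sq_to_K]; simp
  simp only [e, norm_zero] at lim2
  rw [tendsto_zero_iff_norm_tendsto_zero]
  have := lim2.sqrt
  simpa using this

/-- Product rule. -/
lemma hasDerivAt_U_comp (G : SelfAdjointDynamics H) {y : ℝ → H} {y' z : H} {t : ℝ}
    (hy : HasDerivAt y y' t) (hz : HasDerivAt (fun τ => G.U τ (y t)) z t) :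
    HasDerivAt (fun τ => G.U τ (y τ)) (G.U t y' + z) t := by
  rw [hasDerivAt_iff_isLittleO] at *
  have h1 : (fun τ => G.U τ (y τ - y t - (τ - t) • y')) =o[𝓝 t] fun τ => τ - t := by
    rw [← Asymptotics.isLittleO_norm_left]
    simpa only [LinearIsometryEquiv.norm_map, Asymptotics.isLittleO_norm_left] using hy
  have h2 : (fun τ => (τ - t) • (G.U τ y' - G.U t y')) =o[𝓝 t] fun τ => τ - t := by
    have hc : Tendsto (fun τ => G.U τ y' - G.U t y') (𝓝 t) (𝓝 0) := by
      have := ((G.U_cont y').tendsto t).sub_const (G.U t y')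
      simpa using this
    have := (Asymptotics.isBigO_refl (fun τ : ℝ => τ - t) (𝓝 t)).smul_isLittleO
      ((Asymptotics.isLittleO_one_iff ℝ).2 hc)
    simpa using this
  refine ((h1.add h2).add hz).congr_left fun τ => ?_
  have e : G.U τ ((τ - t) • y') = (τ - t) • G.U τ y' := by
    rw [← Complex.coe_smul, ← Complex.coe_smul, map_smul]
  rw [map_sub, map_sub, e]
  simp only [smul_sub, smul_add]
  abel

lemma hasDerivAt_w (GA GB : SelfAdjointDynamics H) (u : H) (t : ℝ) :
    HasDerivAt (fun τ => GA.U τ (RC GA (RC GB (GB.U (-τ) u))))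
      (GA.U t ((-Complex.I) • (RC GA (GB.U (-t) u) - RC GB (GB.U (-t) u)))) t := by
  have h0 := hasDerivAt_U_neg_RC GB t u
  have h1 : HasDerivAt (fun τ => RC GA (RC GB (GB.U (-τ) u)))
      (RC GA (-(GB.U (-t) (RC GB u + Complex.I • u)))) t := by
    simp_rw [← U_RC GB]
    exact (((RC GA).restrictScalars ℝ).hasFDerivAt.comp_hasDerivAt t h0)
  refine (hasDerivAt_U_comp GA h1 (hasDerivAt_U_RC GA t _)).congr_deriv ?_
  rw [← map_add]
  congr 1
  simp only [map_add, map_neg, map_smul, U_RC, smul_sub, neg_smul]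
  abel

end
end KKB

namespace KKB
section

variable {H : Type*} [NormedAddCommGroup H] [InnerProductSpace ℂ H] [CompleteSpace H]

/-- Finite rank structure. -/
lemma exists_finite_rank (D : H →L[ℂ] H) (hfin : ∃ (m : ℕ) (v : Fin m → H), ∀ x : H,
      D x ∈ Submodule.span ℂ (Set.range v)) :
    ∃ (n : ℕ) (f b : Fin n → H), ∀ x, D x = ∑ j, ⟪f j, x⟫_ℂ • b j := by
  obtain ⟨m, v, hv⟩ := hfin
  have : FiniteDimensional ℂ (Submodule.span ℂ (Set.range v)) :=
    FiniteDimensional.span_of_finite ℂ (Set.finite_range v)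
  let b := stdOrthonormalBasis ℂ (Submodule.span ℂ (Set.range v))
  refine ⟨_, fun j => D.adjoint (b j), fun j => (b j : H), fun x => ?_⟩
  have h := b.sum_repr ⟨D x, hv x⟩
  have h2 := congrArg (fun z : Submodule.span ℂ (Set.range v) => (z : H)) h
  simp only [Submodule.coe_sum, Submodule.coe_smul] at h2
  rw [← h2]
  refine Finset.sum_congr rfl fun j _ => ?_
  rw [ContinuousLinearMap.adjoint_inner_left, b.repr_apply_apply]
  rfl

section Pearson

variable (GA GB : SelfAdjointDynamics H) (u : H)

/-- The curve of Pearson's argument. -/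
def w (τ : ℝ) : H := GA.U τ (RC GA (RC GB (GB.U (-τ) u)))

/-- Its derivative. -/
def wd (τ : ℝ) : H := GA.U τ ((-Complex.I) • (RC GA (GB.U (-τ) u) - RC GB (GB.U (-τ) u)))

lemma w_deriv (τ : ℝ) : HasDerivAt (w GA GB u) (wd GA GB u τ) τ := hasDerivAt_w GA GB u τ

lemma continuous_U_joint {y : ℝ → H} (G : SelfAdjointDynamics H) (hy : Continuous y) :
    Continuous fun τ => G.U τ (y τ) := by
  rw [continuous_iff_continuousAt]
  intro t
  have h1 : Tendsto (fun τ => G.U τ (y τ - y t)) (𝓝 t) (𝓝 0) := by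
    rw [tendsto_zero_iff_norm_tendsto_zero]
    simp only [LinearIsometryEquiv.norm_map]
    rw [← tendsto_zero_iff_norm_tendsto_zero]
    simpa using (hy.tendsto t).sub_const (y t)
  have := h1.add ((G.U_cont (y t)).tendsto t)
  simpa [ContinuousAt] using this

lemma continuous_wd : Continuous (wd GA GB u) := by
  refine continuous_U_joint GA ?_
  have := continuous_U_neg GB u
  fun_prop

lemma norm_w_le (τ : ℝ) : ‖w GA GB u τ‖ ≤ ‖RC GA ∘L RC GB‖ * ‖u‖ := by
  rw [w, LinearIsometryEquiv.norm_map]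
  simpa using (RC GA ∘L RC GB).le_opNorm (GB.U (-τ) u)

variable {n : ℕ} {f b : Fin n → H}

lemma wd_eq (hD : ∀ x, RC GA x - RC GB x = ∑ j, ⟪f j, x⟫_ℂ • b j) (τ : ℝ) :
    wd GA GB u τ = (-Complex.I) • ∑ j, ⟪f j, GB.U (-τ) u⟫_ℂ • GA.U τ (b j) := by
  simp [wd, hD, map_sum]

lemma wd_tendsto {u' : H} (hu' : Nice GB u')
    (hD : ∀ x, RC GA x - RC GB x = ∑ j, ⟪f j, x⟫_ℂ • b j) :
    Tendsto (wd GA GB (RC GB u')) atTop (𝓝 0) := by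
  rw [tendsto_zero_iff_norm_tendsto_zero]
  have h : Tendsto (fun τ => ∑ j, ‖⟪f j, GB.U (-τ) (RC GB u')⟫_ℂ‖ * ‖b j‖) atTop (𝓝 0) := by
    have : Tendsto (fun τ => ∑ j, ‖⟪f j, GB.U (-τ) (RC GB u')⟫_ℂ‖ * ‖b j‖) atTop
      (𝓝 (∑ j : Fin n, ‖(0:ℂ)‖ * ‖b j‖)) :=
      tendsto_finsetSum _ fun j _ => ((hu'.tendsto (f j)).norm).mul_const _
    simpa using this
  refine squeeze_zero (fun _ => norm_nonneg _) (fun τ => ?_) h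
  rw [wd_eq GA GB _ hD, norm_smul, norm_neg, norm_I, one_mul]
  refine (norm_sum_le _ _).trans (Finset.sum_le_sum fun j _ => ?_)
  rw [norm_smul, LinearIsometryEquiv.norm_map]

lemma w_sub_tendsto {u' : H} (hu' : Nice GB u')
    (hD : ∀ x, RC GA x - RC GB x = ∑ j, ⟪f j, x⟫_ℂ • b j) (t s : ℝ) :
    Tendsto (fun a => w GA GB (RC GB u') (t + a) - w GA GB (RC GB u') (s + a)) atTop (𝓝 0) := by
  rw [Metric.tendsto_atTop]
  intro ε hε
  have h := wd_tendsto GA GB hu' hD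
  rw [Metric.tendsto_atTop] at h
  have hd : 0 < ε / (|t - s| + 1) := by positivity
  obtain ⟨N, hN⟩ := h _ hd
  refine ⟨N + |t| + |s|, fun a ha => ?_⟩
  have h1 := Convex.norm_image_sub_le_of_norm_hasDerivWithin_le (s := Ici N)
    (f := w GA GB (RC GB u')) (f' := wd GA GB (RC GB u')) (C := ε / (|t - s| + 1))
    (x := s + a) (y := t + a)
    (fun x _ => (w_deriv GA GB (RC GB u') x).hasDerivWithinAt)
    (fun x hx => by simpa using (hN x hx).le) (convex_Ici N)
    (by simp only [mem_Ici]; linarith [neg_abs_le s, abs_nonneg t])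
    (by simp only [mem_Ici]; linarith [neg_abs_le t, abs_nonneg s])
  rw [dist_zero_right]
  refine h1.trans_lt ?_
  rw [add_sub_add_right_eq_sub, Real.norm_eq_abs, div_mul_eq_mul_div, div_lt_iff₀ (by positivity)]
  nlinarith

/-- majorant for the inner products -/
lemma inner_wd_w_le (hD : ∀ x, RC GA x - RC GB x = ∑ j, ⟪f j, x⟫_ℂ • b j) (η : ℝ) (hη : 0 < η)
    (τ σ : ℝ) :
    ‖⟪wd GA GB u τ, w GA GB u σ⟫_ℂ‖ ≤ ∑ j, (‖⟪f j, GB.U (-τ) u⟫_ℂ‖ ^ 2 / η +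
      η * ‖⟪(RC GA ∘L RC GB).adjoint (GA.U (τ - σ) (b j)), GB.U (-σ) u⟫_ℂ‖ ^ 2) := by
  rw [wd_eq GA GB _ hD, inner_smul_left, norm_mul, sum_inner]
  simp only [map_neg, conj_I, norm_neg, norm_I, one_mul]
  refine (norm_sum_le _ _).trans (Finset.sum_le_sum fun j _ => ?_)
  rw [inner_smul_left, norm_mul, RCLike.norm_conj]
  have e : ⟪GA.U τ (b j), w GA GB u σ⟫_ℂ =
      ⟪(RC GA ∘L RC GB).adjoint (GA.U (τ - σ) (b j)), GB.U (-σ) u⟫_ℂ := by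
    rw [ContinuousLinearMap.adjoint_inner_left, w, inner_U_right, sub_eq_add_neg, U_add_apply]
    rfl
  rw [e]
  set p := ‖⟪f j, GB.U (-τ) u⟫_ℂ‖
  set q := ‖⟪(RC GA ∘L RC GB).adjoint (GA.U (τ - σ) (b j)), GB.U (-σ) u⟫_ℂ‖
  have : p ^ 2 / η + η * q ^ 2 - 2 * (p * q) = (p - η * q) ^ 2 / η := by
    field_simp; ring
  have h2 : 0 ≤ (p - η * q) ^ 2 / η := by positivity
  have : 0 ≤ p * q := by positivity
  linarith

/-- integrated majorant. -/
lemma integral_inner_wd_w_le (hu : Nice GB u)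
    (hD : ∀ x, RC GA x - RC GB x = ∑ j, ⟪f j, x⟫_ℂ • b j) :
    ∃ K : ℝ, 0 ≤ K ∧ ∀ η, 0 < η → ∀ T τ σ : ℝ, T ≤ τ →
      IntegrableOn (fun a => ⟪wd GA GB u (τ + a), w GA GB u (σ + a)⟫_ℂ) (Ioi 0) ∧
      ∫ a in Ioi (0:ℝ), ‖⟪wd GA GB u (τ + a), w GA GB u (σ + a)⟫_ℂ‖ ≤
        (∑ j, ∫ a in Ioi T, ‖⟪f j, GB.U (-a) u⟫_ℂ‖ ^ 2) / η + η * K := by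
  obtain ⟨C, hC, h⟩ := hu
  refine ⟨∑ j, C * (‖RC GA ∘L RC GB‖ * ‖b j‖) ^ 2, by positivity, fun η hη T τ σ hT => ?_⟩
  have shift : ∀ (v : H) (c : ℝ), Integrable fun a => ‖⟪v, GB.U (-(c + a)) u⟫_ℂ‖ ^ 2 :=
    fun v c => (h v).1.comp_add_left c
  have hcw : Continuous (w GA GB u) :=
    continuous_iff_continuousAt.2 fun τ => (w_deriv GA GB u τ).continuousAt
  have hcd := continuous_wd GA GB u
  set z : Fin n → H := fun j => (RC GA ∘L RC GB).adjoint (GA.U (τ - σ) (b j)) with hz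
  have hM : Integrable (fun a => ∑ j, (‖⟪f j, GB.U (-(τ + a)) u⟫_ℂ‖ ^ 2 / η +
      η * ‖⟪z j, GB.U (-(σ + a)) u⟫_ℂ‖ ^ 2)) :=
    integrable_finsetSum _ fun j _ =>
      ((shift _ _).div_const _).add ((shift _ _).const_mul _)
  have hle : ∀ a, ‖⟪wd GA GB u (τ + a), w GA GB u (σ + a)⟫_ℂ‖ ≤
      ∑ j, (‖⟪f j, GB.U (-(τ + a)) u⟫_ℂ‖ ^ 2 / η +
      η * ‖⟪z j, GB.U (-(σ + a)) u⟫_ℂ‖ ^ 2) := fun a => by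
    have := inner_wd_w_le GA GB u hD η hη (τ + a) (σ + a)
    rwa [add_sub_add_right_eq_sub] at this
  have hI : Integrable (fun a => ⟪wd GA GB u (τ + a), w GA GB u (σ + a)⟫_ℂ) := by
    refine Integrable.mono' hM ?_ (Eventually.of_forall hle)
    refine Continuous.aestronglyMeasurable ?_
    fun_prop
  refine ⟨hI.integrableOn, ?_⟩
  calc _ ≤ ∫ a in Ioi (0:ℝ), ∑ j, (‖⟪f j, GB.U (-(τ + a)) u⟫_ℂ‖ ^ 2 / η +
      η * ‖⟪z j, GB.U (-(σ + a)) u⟫_ℂ‖ ^ 2) :=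
        integral_mono hI.norm.integrableOn hM.integrableOn hle
    _ = ∑ j, ((∫ a in Ioi (0:ℝ), ‖⟪f j, GB.U (-(τ + a)) u⟫_ℂ‖ ^ 2) / η +
          η * ∫ a in Ioi (0:ℝ), ‖⟪z j, GB.U (-(σ + a)) u⟫_ℂ‖ ^ 2) := by
        rw [integral_finsetSum]
        · refine Finset.sum_congr rfl fun j _ => ?_
          rw [integral_add ((shift _ _).div_const _).integrableOn
            ((shift _ _).const_mul _).integrableOn, integral_div, integral_const_mul]
        · exact fun j _ => (((shift _ _).div_const _).add ((shift _ _).const_mul _)).integrableOn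
    _ ≤ ∑ j, ((∫ a in Ioi T, ‖⟪f j, GB.U (-a) u⟫_ℂ‖ ^ 2) / η +
          η * (C * (‖RC GA ∘L RC GB‖ * ‖b j‖) ^ 2)) := by
        refine Finset.sum_le_sum fun j _ => ?_
        have h1 : ∫ a in Ioi (0:ℝ), ‖⟪f j, GB.U (-(τ + a)) u⟫_ℂ‖ ^ 2 ≤
            ∫ a in Ioi T, ‖⟪f j, GB.U (-a) u⟫_ℂ‖ ^ 2 := by
          have h3 := (measurePreserving_add_left volume τ).setIntegral_preimage_emb
            (MeasurableEquiv.addLeft τ).measurableEmbedding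
            (fun a => ‖⟪f j, GB.U (-a) u⟫_ℂ‖ ^ 2) (Ioi τ)
          have h4 : (fun a : ℝ => τ + a) ⁻¹' Ioi τ = Ioi 0 := by ext a; simp
          rw [h4] at h3
          rw [h3]
          exact setIntegral_mono_set (h _).1.integrableOn
            (Eventually.of_forall fun _ => by positivity)
            (Ioi_subset_Ioi hT).eventuallyLE
        have h2 : ∫ a in Ioi (0:ℝ), ‖⟪z j, GB.U (-(σ + a)) u⟫_ℂ‖ ^ 2 ≤
            C * (‖RC GA ∘L RC GB‖ * ‖b j‖) ^ 2 := by
          calc _ ≤ ∫ a, ‖⟪z j, GB.U (-(σ + a)) u⟫_ℂ‖ ^ 2 :=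
                setIntegral_le_integral (shift _ _) (Eventually.of_forall fun _ => by positivity)
            _ = ∫ a, ‖⟪z j, GB.U (-a) u⟫_ℂ‖ ^ 2 :=
                integral_add_left_eq_self (fun a => ‖⟪z j, GB.U (-a) u⟫_ℂ‖ ^ 2) σ
            _ ≤ C * ‖z j‖ ^ 2 := (h _).2
            _ ≤ _ := by
                have : ‖z j‖ ≤ ‖RC GA ∘L RC GB‖ * ‖b j‖ := by
                  have := (RC GA ∘L RC GB).adjoint.le_opNorm (GA.U (τ - σ) (b j))
                  rwa [LinearIsometryEquiv.norm_map, LinearIsometryEquiv.norm_map] at this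
                gcongr
        gcongr
    _ = _ := by
        rw [Finset.sum_add_distrib, ← Finset.sum_div, ← Finset.mul_sum]

end Pearson

end
end KKB

namespace KKB
section

variable {H : Type*} [NormedAddCommGroup H] [InnerProductSpace ℂ H] [CompleteSpace H]

variable (GA GB : SelfAdjointDynamics H) (u : H)
variable {n : ℕ} {f b : Fin n → H}

lemma inner_w_sub_le {u' : H} (hu' : Nice GB u')
    (hD : ∀ x, RC GA x - RC GB x = ∑ j, ⟪f j, x⟫_ℂ • b j) :
    ∃ K : ℝ, 0 ≤ K ∧ ∀ η, 0 < η → ∀ T t s : ℝ, T ≤ t → T ≤ s →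
      ‖⟪w GA GB (RC GB u') t, w GA GB (RC GB u') t - w GA GB (RC GB u') s⟫_ℂ‖ ≤
        4 * ((∑ j, ∫ a in Ioi T, ‖⟪f j, GB.U (-a) (RC GB u')⟫_ℂ‖ ^ 2) / η + η * K) := by
  obtain ⟨K, hK, h⟩ := integral_inner_wd_w_le GA GB (RC GB u') hu'.RC hD
  refine ⟨K, hK, fun η hη T t s ht hs => ?_⟩
  have hlim := w_sub_tendsto GA GB hu' hD t s
  have hder := w_deriv GA GB (RC GB u')
  have hbd := norm_w_le GA GB (RC GB u')
  set W := w GA GB (RC GB u') with hW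
  set F := wd GA GB (RC GB u') with hF
  set X := (∑ j, ∫ a in Ioi T, ‖⟪f j, GB.U (-a) (RC GB u')⟫_ℂ‖ ^ 2) / η + η * K with hX
  have hs1 : ∀ c a, HasDerivAt (fun a => W (c + a)) (F (c + a)) a := fun c a =>
    (hder (c + a)).comp_const_add c a
  have hψ : ∀ a, HasDerivAt (fun a => ⟪W (t + a), W (t + a) - W (s + a)⟫_ℂ)
      (⟪W (t + a), F (t + a) - F (s + a)⟫_ℂ + ⟪F (t + a), W (t + a) - W (s + a)⟫_ℂ) a := fun a =>
    (hs1 t a).inner ℂ ((hs1 t a).sub (hs1 s a))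
  have htend : Tendsto (fun a => ⟪W (t + a), W (t + a) - W (s + a)⟫_ℂ) atTop (𝓝 0) := by
    rw [tendsto_zero_iff_norm_tendsto_zero]
    have h2 := (hlim.norm).const_mul (‖RC GA ∘L RC GB‖ * ‖RC GB u'‖)
    rw [norm_zero, mul_zero] at h2
    refine squeeze_zero (fun _ => norm_nonneg _) (fun a => ?_) h2
    exact (norm_inner_le_norm _ _).trans (mul_le_mul_of_nonneg_right (hbd _) (norm_nonneg _))
  have hconj : ∀ τ σ, T ≤ τ → IntegrableOn (fun a => ⟪W (σ + a), F (τ + a)⟫_ℂ) (Ioi 0) ∧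
      ∫ a in Ioi (0:ℝ), ‖⟪W (σ + a), F (τ + a)⟫_ℂ‖ ≤ X := fun τ σ hτ => by
    have h1 := h η hη T τ σ hτ
    constructor
    · have := (Complex.conjLIE.toContinuousLinearEquiv.toContinuousLinearMap).integrable_comp h1.1
      simpa [IntegrableOn, inner_conj_symm] using this
    · simp_rw [norm_inner_symm (W _)]
      exact h1.2
  have e : ∀ a, (⟪W (t + a), F (t + a) - F (s + a)⟫_ℂ + ⟪F (t + a), W (t + a) - W (s + a)⟫_ℂ) =
    (⟪W (t + a), F (t + a)⟫_ℂ - ⟪W (t + a), F (s + a)⟫_ℂ) +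
    (⟪F (t + a), W (t + a)⟫_ℂ - ⟪F (t + a), W (s + a)⟫_ℂ) := fun a => by
    rw [inner_sub_right, inner_sub_right]
  simp only [e] at hψ
  have a1 := hconj t t ht
  have a2 := hconj s t hs
  have a3 := h η hη T t t ht
  have a4 := h η hη T t s ht
  have hinteg := integral_Ioi_of_hasDerivAt_of_tendsto' (a := 0) (fun a _ => hψ a)
    ((a1.1.sub a2.1).add (a3.1.sub a4.1)) htend
  simp only [add_zero, zero_sub] at hinteg
  rw [← norm_neg, ← hinteg]
  calc _ ≤ ∫ a in Ioi (0:ℝ), ((‖⟪W (t + a), F (t + a)⟫_ℂ‖ + ‖⟪W (t + a), F (s + a)⟫_ℂ‖) +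
    (‖⟪F (t + a), W (t + a)⟫_ℂ‖ + ‖⟪F (t + a), W (s + a)⟫_ℂ‖)) := by
        refine norm_integral_le_of_norm_le
          ((a1.1.norm.add a2.1.norm).add (a3.1.norm.add a4.1.norm)) (Eventually.of_forall fun a => ?_)
        exact (norm_add_le _ _).trans (add_le_add (norm_sub_le _ _) (norm_sub_le _ _))
    _ = _ := by
        rw [integral_add, integral_add, integral_add]
        exacts [a3.1.norm, a4.1.norm, a1.1.norm, a2.1.norm, a1.1.norm.add a2.1.norm,
          a3.1.norm.add a4.1.norm]
    _ ≤ 4 * X := by linarith [a1.2, a2.2, a3.2, a4.2]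

lemma w_cauchy {u' : H} (hu' : Nice GB u')
    (hD : ∀ x, RC GA x - RC GB x = ∑ j, ⟪f j, x⟫_ℂ • b j) :
    CauchySeq (w GA GB (RC GB u')) := by
  obtain ⟨K, hK, h⟩ := inner_w_sub_le GA GB hu' hD
  rw [Metric.cauchySeq_iff]
  intro ε hε
  obtain ⟨C, -, hn⟩ := hu'.RC
  have htail : Tendsto (fun T => ∑ j, ∫ a in Ioi T, ‖⟪f j, GB.U (-a) (RC GB u')⟫_ℂ‖ ^ 2) atTop
      (𝓝 0) := by
    have : Tendsto (fun T => ∑ j, ∫ a in Ioi T, ‖⟪f j, GB.U (-a) (RC GB u')⟫_ℂ‖ ^ 2) atTop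
        (𝓝 (∑ j : Fin n, 0)) := by
      refine tendsto_finsetSum _ fun j _ => ?_
      have h1 := intervalIntegral_tendsto_integral_Ioi 0 (hn (f j)).1.integrableOn tendsto_id
      have h2 := h1.const_sub (∫ a in Ioi (0:ℝ), ‖⟪f j, GB.U (-a) (RC GB u')⟫_ℂ‖ ^ 2)
      rw [sub_self] at h2
      refine h2.congr fun T => ?_
      rw [id, ← intervalIntegral.integral_Ioi_sub_Ioi' (hn (f j)).1.integrableOn
        (hn (f j)).1.integrableOn, sub_sub_cancel]
    simpa using this
  set η : ℝ := ε ^ 2 / (32 * (K + 1)) with hη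
  have hη0 : 0 < η := by positivity
  have hηK : η * K ≤ ε ^ 2 / 32 := by
    rw [hη, div_mul_eq_mul_div, div_le_div_iff₀ (by positivity) (by positivity)]
    nlinarith [sq_nonneg ε]
  obtain ⟨T, hT⟩ := ((tendsto_order.1 htail).2 (η * (ε ^ 2 / 32)) (by positivity)).exists
  refine ⟨T, fun t ht s hs => ?_⟩
  have hX : (∑ j, ∫ a in Ioi T, ‖⟪f j, GB.U (-a) (RC GB u')⟫_ℂ‖ ^ 2) / η < ε ^ 2 / 32 := by
    rw [div_lt_iff₀ hη0, mul_comm]; exact hT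
  have h1 := h η hη0 T t s ht hs
  have h2 := h η hη0 T s t hs ht
  set W := w GA GB (RC GB u')
  rw [dist_eq_norm]
  have e : ((‖W t - W s‖ : ℂ)) ^ 2 = ⟪W t, W t - W s⟫_ℂ + ⟪W s, W s - W t⟫_ℂ := by
    have := inner_self_eq_norm_sq_to_K (𝕜 := ℂ) (W t - W s)
    simp only [coe_algebraMap] at this
    rw [← this, inner_sub_left, ← inner_neg_neg (W s) (W t - W s), neg_sub, inner_neg_left]
    ring
  have e2 : ‖W t - W s‖ ^ 2 ≤ ‖⟪W t, W t - W s⟫_ℂ‖ + ‖⟪W s, W s - W t⟫_ℂ‖ := by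
    have := congrArg norm e
    rw [norm_pow, Complex.norm_real, norm_norm] at this
    rw [this]
    exact norm_add_le _ _
  refine lt_of_pow_lt_pow_left₀ 2 hε.le ?_
  have : 0 < ε ^ 2 := by positivity
  linarith

/-- the wave operator family -/
def WW (τ : ℝ) (y : H) : H := GA.U τ (GB.U (-τ) y)

/-- Vectors on which the wave operator exists. -/
def S : Submodule ℂ H where
  carrier := {y | ∃ z, Tendsto (fun τ => WW GA GB τ y) atTop (𝓝 z)}
  add_mem' := by
    rintro x y ⟨z, hz⟩ ⟨z', hz'⟩
    exact ⟨z + z', by simpa [WW] using hz.add hz'⟩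
  zero_mem' := ⟨0, by simp [WW]⟩
  smul_mem' := by
    rintro c x ⟨z, hz⟩
    exact ⟨c • z, by simpa [WW] using hz.const_smul c⟩

lemma S_closed : IsClosed (S GA GB : Set H) := by
  rw [← isSeqClosed_iff_isClosed]
  intro y x hy hx
  suffices CauchySeq (fun τ => WW GA GB τ x) from cauchySeq_tendsto_of_complete this
  rw [Metric.cauchySeq_iff]
  intro ε hε
  rw [Metric.tendsto_atTop] at hx
  obtain ⟨N, hN⟩ := hx (ε / 3) (by positivity)
  obtain ⟨z, hz⟩ := hy N
  obtain ⟨T, hT⟩ := Metric.cauchySeq_iff.1 hz.cauchySeq (ε / 3) (by positivity)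
  refine ⟨T, fun t ht s hs => ?_⟩
  have hd : ∀ τ, dist (WW GA GB τ x) (WW GA GB τ (y N)) < ε / 3 := fun τ => by
    rw [WW, WW, LinearIsometryEquiv.dist_map, LinearIsometryEquiv.dist_map, dist_comm]
    exact hN N le_rfl
  have h1 := hT t ht s hs
  have h2 := hd t
  have h3 := hd s
  rw [dist_comm] at h3
  linarith [dist_triangle4 (WW GA GB t x) (WW GA GB t (y N)) (WW GA GB s (y N)) (WW GA GB s x)]

lemma RC3_mem {u' : H} (hu' : Nice GB u')
    (hD : ∀ x, RC GA x - RC GB x = ∑ j, ⟪f j, x⟫_ℂ • b j) :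
    RC GB (RC GB (RC GB u')) ∈ S GA GB := by
  obtain ⟨z, hz⟩ := cauchySeq_tendsto_of_complete (w_cauchy GA GB hu' hD)
  refine ⟨z, ?_⟩
  have h0 : Tendsto (wd GA GB (RC GB (RC GB u'))) atTop (𝓝 0) := wd_tendsto GA GB hu'.RC hD
  have h1 := h0.const_smul (Complex.I)
  have h2 := hz.sub h1
  simp only [smul_zero, sub_zero] at h2
  refine h2.congr fun τ => ?_
  rw [w, wd, ← map_smul, smul_smul, ← map_sub, WW]
  congr 1
  simp only [mul_neg, I_mul_I, neg_neg, one_smul, ← U_RC]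
  simp [U_RC]

lemma step (G : SelfAdjointDynamics H) (S' : Submodule ℂ H) (hS' : IsClosed (S' : Set H)) (y : H)
    (h : ∀ t, G.U t (RC G y) ∈ S') : y ∈ S' := by
  have h0 : RC G y ∈ S' := by simpa [U_zero_apply] using h 0
  have hd := hasDerivAt_U_RC G 0 y
  rw [U_zero_apply] at hd
  have h1 : RC G y + Complex.I • y ∈ S' := by
    have hs := hd.tendsto_slope
    refine hS'.mem_of_tendsto hs (Eventually.of_forall fun t => ?_)
    rw [slope_def_module]
    rw [← Complex.coe_smul]
    exact S'.smul_mem _ (S'.sub_mem (h t) (h 0))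
  have h2 := S'.sub_mem h1 h0
  rw [add_sub_cancel_left] at h2
  have h3 := S'.smul_mem (-Complex.I) h2
  simpa [smul_smul] using h3

lemma mem_S_of_nice {u' : H} (hu' : Nice GB u')
    (hD : ∀ x, RC GA x - RC GB x = ∑ j, ⟪f j, x⟫_ℂ • b j) : u' ∈ S GA GB := by
  have red : ∀ k : ℕ, (∀ y, Nice GB y → ((KKB.RC GB) ^ (k + 1)) y ∈ S GA GB) →
      (∀ y, Nice GB y → ((KKB.RC GB) ^ k) y ∈ S GA GB) := by
    intro k hk y hy
    refine step GB ((S GA GB).comap ((KKB.RC GB) ^ k).toLinearMap)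
      ((S_closed GA GB).preimage ((KKB.RC GB) ^ k).continuous) y fun t => ?_
    have := hk _ (hy.U t)
    rw [pow_succ] at this
    rw [U_RC]
    exact this
  have h3 : ∀ y, Nice GB y → ((KKB.RC GB) ^ 3) y ∈ S GA GB := fun y hy => by
    exact RC3_mem GA GB hy hD
  exact red 0 (red 1 (red 2 h3)) u' hu'

end
end KKB

namespace KKB
section
open scoped ComplexConjugate

variable {H : Type*} [NormedAddCommGroup H] [InnerProductSpace ℂ H] [CompleteSpace H]

lemma fub (κ g : ℝ → ℂ) (hκ : Integrable κ) (hg : Integrable g) :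
    ∫ p : ℝ × ℝ, conj (g p.1) * g p.2 *
      (∫ l : ℝ, Complex.exp (Complex.I * ((p.2 - p.1 : ℝ) : ℂ) * (l : ℂ)) * κ l) =
    ∫ l : ℝ, κ l * ((‖∫ t : ℝ, g t * Complex.exp (Complex.I * (t : ℂ) * (l : ℂ))‖ : ℂ)) ^ 2 := by
  have hgc : Integrable (fun s => conj (g s)) := by
    simpa using (Complex.conjLIE.toContinuousLinearEquiv.toContinuousLinearMap).integrable_comp hg
  have hI : Integrable (fun q : (ℝ × ℝ) × ℝ => (conj (g q.1.1) * g q.1.2) *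
      (Complex.exp (Complex.I * ((q.1.2 - q.1.1 : ℝ) : ℂ) * (q.2 : ℂ)) * κ q.2)) 
      (((volume : Measure ℝ).prod volume).prod volume) := by
    have h1 := (hgc.mul_prod hg).mul_prod hκ
    refine Integrable.mono h1 ?_ (Eventually.of_forall fun q => ?_)
    · have h2 : Continuous fun q : (ℝ × ℝ) × ℝ =>
        Complex.exp (Complex.I * ((q.1.2 - q.1.1 : ℝ) : ℂ) * (q.2 : ℂ)) := by fun_prop
      refine (h2.aestronglyMeasurable.mul h1.aestronglyMeasurable).congr
        (Eventually.of_forall fun q => ?_)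
      simp only [Pi.mul_apply]
      ring
    · have : ‖Complex.exp (Complex.I * ((q.1.2 - q.1.1 : ℝ) : ℂ) * (q.2 : ℂ))‖ = 1 := by
        rw [mul_assoc, ← Complex.ofReal_mul, mul_comm, Complex.norm_exp_ofReal_mul_I]
      rw [norm_mul, norm_mul (Complex.exp _), this, one_mul, norm_mul (conj _ * _)]
  calc _ = ∫ p : ℝ × ℝ, ∫ l : ℝ, (conj (g p.1) * g p.2) *
      (Complex.exp (Complex.I * ((p.2 - p.1 : ℝ) : ℂ) * (l : ℂ)) * κ l) := by
        simp_rw [integral_const_mul]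
    _ = ∫ l : ℝ, ∫ p : ℝ × ℝ, (conj (g p.1) * g p.2) *
      (Complex.exp (Complex.I * ((p.2 - p.1 : ℝ) : ℂ) * (l : ℂ)) * κ l) :=
        integral_integral_swap hI
    _ = _ := by
        refine integral_congr_ae (Eventually.of_forall fun l => ?_)
        simp only
        have e : ∀ p : ℝ × ℝ, (conj (g p.1) * g p.2) *
          (Complex.exp (Complex.I * ((p.2 - p.1 : ℝ) : ℂ) * (l : ℂ)) * κ l) =
          κ l * ((conj (g p.1 * Complex.exp (Complex.I * (p.1 : ℂ) * (l : ℂ)))) *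
            (g p.2 * Complex.exp (Complex.I * (p.2 : ℂ) * (l : ℂ)))) := fun p => by
          have : Complex.exp (Complex.I * ((p.2 - p.1 : ℝ) : ℂ) * (l : ℂ)) =
            conj (Complex.exp (Complex.I * (p.1 : ℂ) * (l : ℂ))) *
              Complex.exp (Complex.I * (p.2 : ℂ) * (l : ℂ)) := by
            rw [← Complex.exp_conj, ← Complex.exp_add]
            congr 1
            simp
            ring
          rw [this, map_mul]
          ring
        simp_rw [e]
        rw [integral_const_mul]
        congr 1
        have := integral_prod_mul (μ := (volume : Measure ℝ)) (ν := (volume : Measure ℝ))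
          (fun s => conj (g s * Complex.exp (Complex.I * (s : ℂ) * (l : ℂ))))
          (fun s => (g s * Complex.exp (Complex.I * (s : ℂ) * (l : ℂ))))
        rw [← Measure.volume_eq_prod] at this
        rw [this, integral_conj, RCLike.conj_mul]
        simp

lemma inner_integral_self (Y : ℝ → H) (hY : Integrable Y) :
    ∫ p : ℝ × ℝ, ⟪Y p.1, Y p.2⟫_ℂ = ⟪∫ s, Y s, ∫ s, Y s⟫_ℂ := by
  have hI : Integrable (fun p : ℝ × ℝ => ⟪Y p.1, Y p.2⟫_ℂ)
      ((volume : Measure ℝ).prod volume) := by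
    refine Integrable.mono' (hY.norm.mul_prod hY.norm) ?_
      (Eventually.of_forall fun p => norm_inner_le_norm _ _)
    exact hY.aestronglyMeasurable.comp_fst.inner hY.aestronglyMeasurable.comp_snd
  rw [Measure.volume_eq_prod, integral_prod _ hI]
  have e : ∀ s, ∫ t, ⟪Y s, Y t⟫_ℂ = conj ⟪∫ t, Y t, Y s⟫_ℂ := fun s => by
    rw [integral_inner hY, inner_conj_symm]
  simp_rw [e]
  rw [integral_conj, integral_inner hY, inner_conj_symm]

lemma shear_integral (a Γ : ℝ → ℝ) (ha : Integrable a) (hΓ : Integrable Γ) :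
    (Integrable (fun p : ℝ × ℝ => a p.1 * Γ (-p.1 + p.2)) ∧
    ∫ p : ℝ × ℝ, a p.1 * Γ (-p.1 + p.2) = (∫ s, a s) * ∫ s, Γ s) ∧
    (Integrable (fun p : ℝ × ℝ => a p.2 * Γ (-p.2 + p.1)) ∧
    ∫ p : ℝ × ℝ, a p.2 * Γ (-p.2 + p.1) = (∫ s, a s) * ∫ s, Γ s) := by
  have h := ha.mul_prod hΓ
  have m1 := measurePreserving_prod_neg_add (volume : Measure ℝ) (volume : Measure ℝ)
  have m2 := measurePreserving_prod_neg_add_swap (volume : Measure ℝ) (volume : Measure ℝ)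
  refine ⟨⟨m1.integrable_comp_of_integrable h, ?_⟩, m2.integrable_comp_of_integrable h, ?_⟩
  · rw [← integral_prod_mul (μ := (volume : Measure ℝ)) (ν := (volume : Measure ℝ)) a Γ,
      ← m1.map_eq, integral_map m1.measurable.aemeasurable]
    · rfl
    · rw [m1.map_eq]; exact h.aestronglyMeasurable
  · rw [← integral_prod_mul (μ := (volume : Measure ℝ)) (ν := (volume : Measure ℝ)) a Γ,
      ← m2.map_eq, integral_map m2.measurable.aemeasurable]
    · rfl
    · rw [m2.map_eq]; exact h.aestronglyMeasurable

lemma gauss_bound : ∃ C : ℝ, 0 ≤ C ∧ ∀ g : ℝ → ℂ, Integrable g → Integrable (fun s => ‖g s‖ ^ 2) →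
    ∫ l : ℝ, Real.exp (-l ^ 2) *
      ‖∫ t : ℝ, g t * Complex.exp (Complex.I * (t : ℂ) * (l : ℂ))‖ ^ 2 ≤ C * ∫ s, ‖g s‖ ^ 2 := by
  set c : ℝ := ‖((Real.pi : ℂ) / 1) ^ (1 / 2 : ℂ)‖ with hc
  set Γ : ℝ → ℝ := fun τ => c * Real.exp (-(1 / 4) * τ ^ 2) with hΓd
  have hΓ : Integrable Γ := (integrable_exp_neg_mul_sq (by norm_num)).const_mul _
  have hΓ0 : ∀ τ, 0 ≤ Γ τ := fun τ => by positivity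
  have hΓe : ∀ τ, Γ (-τ) = Γ τ := fun τ => by simp [hΓd]
  refine ⟨∫ τ, Γ τ, integral_nonneg hΓ0, fun g hg hg2 => ?_⟩
  have hκ : Integrable (fun l : ℝ => Complex.exp (-1 * (l : ℂ) ^ 2)) :=
    integrable_cexp_neg_mul_sq (by simp)
  have hF := fub _ g hκ hg
  have hft : ∀ τ : ℝ, ‖∫ l : ℝ, Complex.exp (Complex.I * (τ : ℂ) * (l : ℂ)) *
      Complex.exp (-1 * (l : ℂ) ^ 2)‖ = Γ τ := fun τ => by
    rw [fourierIntegral_gaussian (by simp) (τ : ℂ), norm_mul, Complex.norm_exp, hΓd]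
    simp only [hc]
    congr 2
    have : -(τ : ℂ) ^ 2 / (4 * 1) = ((-(1 / 4) * τ ^ 2 : ℝ) : ℂ) := by push_cast; ring
    rw [this, Complex.ofReal_re]
  have hN : ∫ l : ℝ, Real.exp (-l ^ 2) *
      ‖∫ t : ℝ, g t * Complex.exp (Complex.I * (t : ℂ) * (l : ℂ))‖ ^ 2 =
      ‖∫ p : ℝ × ℝ, conj (g p.1) * g p.2 *
      (∫ l : ℝ, Complex.exp (Complex.I * ((p.2 - p.1 : ℝ) : ℂ) * (l : ℂ)) *
        Complex.exp (-1 * (l : ℂ) ^ 2))‖ := by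
    rw [hF]
    have : ∀ l : ℝ, Complex.exp (-1 * (l : ℂ) ^ 2) *
      ((‖∫ t : ℝ, g t * Complex.exp (Complex.I * (t : ℂ) * (l : ℂ))‖ : ℂ)) ^ 2 =
      ((Real.exp (-l ^ 2) *
      ‖∫ t : ℝ, g t * Complex.exp (Complex.I * (t : ℂ) * (l : ℂ))‖ ^ 2 : ℝ) : ℂ) := fun l => by
      push_cast; ring_nf
    simp_rw [this]
    rw [integral_complex_ofReal, Complex.norm_real, Real.norm_eq_abs, abs_of_nonneg]
    exact integral_nonneg fun l => by positivity
  rw [hN]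
  obtain ⟨⟨i1, e1⟩, i2, e2⟩ := shear_integral _ Γ hg2 hΓ
  calc _ ≤ ∫ p : ℝ × ℝ, (‖g p.1‖ ^ 2 * Γ (-p.1 + p.2) + ‖g p.2‖ ^ 2 * Γ (-p.2 + p.1)) / 2 := by
        refine norm_integral_le_of_norm_le ((i1.add i2).div_const 2)
          (Eventually.of_forall fun p => ?_)
        rw [norm_mul, hft, norm_mul, RCLike.norm_conj]
        have h1 : Γ (-p.1 + p.2) = Γ (p.2 - p.1) := by congr 1; ring
        have h2 : Γ (-p.2 + p.1) = Γ (p.2 - p.1) := by rw [← hΓe]; congr 1; ring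
        rw [h1, h2]
        nlinarith [hΓ0 (p.2 - p.1), sq_nonneg (‖g p.1‖ - ‖g p.2‖),
          mul_nonneg (hΓ0 (p.2 - p.1)) (sq_nonneg (‖g p.1‖ - ‖g p.2‖))]
    _ = _ := by
        rw [integral_div, integral_add i1 i2, e1, e2]; ring

end
end KKB

namespace KKB
section
open scoped ComplexConjugate

variable {H : Type*} [NormedAddCommGroup H] [InnerProductSpace ℂ H] [CompleteSpace H]

lemma nice_of_density (G : SelfAdjointDynamics H) (u : H) (k : ℝ → ℝ)
    (hk : AEStronglyMeasurable k) (M : ℝ) (hM : 0 ≤ M)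
    (hkM : ∀ l, |k l| ≤ M * Real.exp (-l ^ 2))
    (hu : ∀ t : ℝ, ⟪G.U t u, u⟫_ℂ =
        ∫ l : ℝ, Complex.exp (Complex.I * (t : ℂ) * (l : ℂ)) * (k l : ℂ)) : Nice G u := by
  obtain ⟨C, hC, hG⟩ := gauss_bound
  have hexp : Integrable (fun l : ℝ => Real.exp (-l ^ 2)) := by
    simpa using integrable_exp_neg_mul_sq (b := 1) one_pos
  have hki : Integrable k := Integrable.mono' (hexp.const_mul M) hk (Eventually.of_forall hkM)
  have key : ∀ (v : H) (T : ℝ), 0 ≤ T →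
      ∫ τ in (-T)..T, ‖⟪v, G.U (-τ) u⟫_ℂ‖ ^ 2 ≤ M * C * ‖v‖ ^ 2 := by
    intro v T hT
    have hTT : -T ≤ T := by linarith
    set g0 : ℝ → ℂ := fun τ => ⟪G.U (-τ) u, v⟫_ℂ with hg0
    have hcU := continuous_U_neg G u
    have hcg0 : Continuous g0 := hcU.inner continuous_const
    set g : ℝ → ℂ := (Ioc (-T) T).indicator g0 with hgdef
    have hg : Integrable g := by
      rw [hgdef, integrable_indicator_iff measurableSet_Ioc]
      exact (hcg0.integrableOn_Icc).mono_set Ioc_subset_Icc_self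
    have hgs : (fun s => ‖g s‖ ^ 2) = (Ioc (-T) T).indicator (fun s => ‖g0 s‖ ^ 2) := by
      ext s
      by_cases hs : s ∈ Ioc (-T) T <;> simp [hgdef, hs]
    have hg2 : Integrable (fun s => ‖g s‖ ^ 2) := by
      rw [hgs, integrable_indicator_iff measurableSet_Ioc]
      exact ((by fun_prop : Continuous fun s => ‖g0 s‖ ^ 2).integrableOn_Icc).mono_set
        Ioc_subset_Icc_self
    have hI : ∫ s, ‖g s‖ ^ 2 = ∫ τ in (-T)..T, ‖⟪v, G.U (-τ) u⟫_ℂ‖ ^ 2 := by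
      rw [hgs, integral_indicator measurableSet_Ioc, intervalIntegral.integral_of_le hTT]
      simp_rw [hg0, norm_inner_symm v]
    rw [← hI]
    set I := ∫ s, ‖g s‖ ^ 2 with hIdef
    have hI0 : 0 ≤ I := integral_nonneg fun _ => by positivity
    set Y : ℝ → H := fun s => g s • G.U (-s) u with hYdef
    have hY : Integrable Y := by
      refine Integrable.mono' (hg.norm.mul_const ‖u‖)
        (hg.aestronglyMeasurable.smul hcU.aestronglyMeasurable) (Eventually.of_forall fun s => ?_)
      simp [hYdef, norm_smul]
    set y := ∫ s, Y s with hy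
    have h1 : (I : ℂ) = ⟪v, y⟫_ℂ := by
      rw [hy, ← integral_inner hY, hIdef, ← integral_complex_ofReal]
      refine integral_congr_ae (Eventually.of_forall fun s => ?_)
      simp only [hYdef, inner_smul_right]
      by_cases hs : s ∈ Ioc (-T) T
      · simp only [hgdef, hs, indicator_of_mem, hg0]
        rw [← inner_conj_symm v, RCLike.mul_conj]
        push_cast
        rfl
      · simp [hgdef, hs]
    have h2 : I ≤ ‖v‖ * ‖y‖ := by
      have := norm_inner_le_norm (𝕜 := ℂ) v y
      rw [← h1, Complex.norm_real, Real.norm_eq_abs, abs_of_nonneg hI0] at this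
      exact this
    have h3 : ‖y‖ ^ 2 ≤ M * C * I := by
      have e1 := inner_integral_self Y hY
      have e2 := fub (fun l => (k l : ℂ)) g hki.ofReal hg
      have e3 : ∫ p : ℝ × ℝ, ⟪Y p.1, Y p.2⟫_ℂ = ∫ p : ℝ × ℝ, conj (g p.1) * g p.2 *
          (∫ l : ℝ, Complex.exp (Complex.I * ((p.2 - p.1 : ℝ) : ℂ) * (l : ℂ)) * k l) := by
        refine integral_congr_ae (Eventually.of_forall fun p => ?_)
        simp only [hYdef, inner_smul_left, inner_smul_right]
        rw [← hu, inner_U_right, neg_neg, ← U_add_apply, neg_add_eq_sub]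
        ring
      have e4 : ‖y‖ ^ 2 = ‖⟪y, y⟫_ℂ‖ := by
        rw [inner_self_eq_norm_sq_to_K]; simp
      rw [e4, hy, ← e1, e3, e2]
      have hbdd : ∀ l : ℝ, ‖∫ t : ℝ, g t * Complex.exp (Complex.I * (t : ℂ) * (l : ℂ))‖ ≤
          ∫ t, ‖g t‖ := fun l => by
        refine (norm_integral_le_integral_norm _).trans (le_of_eq ?_)
        refine integral_congr_ae (Eventually.of_forall fun t => ?_)
        have : ‖Complex.exp (Complex.I * (t : ℂ) * (l : ℂ))‖ = 1 := by
          rw [mul_assoc, ← Complex.ofReal_mul, mul_comm, Complex.norm_exp_ofReal_mul_I]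
        simp only [norm_mul, this, mul_one]
      have hcont : Continuous fun l : ℝ =>
          ∫ t : ℝ, g t * Complex.exp (Complex.I * (t : ℂ) * (l : ℂ)) := by
        refine continuous_of_dominated (bound := fun t => ‖g t‖) (fun l => ?_) (fun l => ?_)
          hg.norm ?_
        · exact hg.aestronglyMeasurable.mul (by fun_prop :
            Continuous fun t : ℝ => Complex.exp (Complex.I * (t : ℂ) * (l : ℂ))).aestronglyMeasurable
        · refine Eventually.of_forall fun t => ?_
          have : ‖Complex.exp (Complex.I * (t : ℂ) * (l : ℂ))‖ = 1 := by
            rw [mul_assoc, ← Complex.ofReal_mul, mul_comm, Complex.norm_exp_ofReal_mul_I]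
          rw [norm_mul, this, mul_one]
        · exact Eventually.of_forall fun t => by fun_prop
      have hinteg : Integrable (fun l : ℝ => M * (Real.exp (-l ^ 2) *
          ‖∫ t : ℝ, g t * Complex.exp (Complex.I * (t : ℂ) * (l : ℂ))‖ ^ 2)) := by
        refine Integrable.const_mul ?_ M
        refine Integrable.mono' (hexp.mul_const ((∫ t, ‖g t‖) ^ 2)) ?_
          (Eventually.of_forall fun l => ?_)
        · refine Continuous.aestronglyMeasurable ?_
          fun_prop
        · rw [Real.norm_eq_abs, abs_of_nonneg (by positivity)]
          gcongr
          exact hbdd l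
      calc _ ≤ ∫ l : ℝ, M * (Real.exp (-l ^ 2) *
          ‖∫ t : ℝ, g t * Complex.exp (Complex.I * (t : ℂ) * (l : ℂ))‖ ^ 2) := by
            refine norm_integral_le_of_norm_le hinteg (Eventually.of_forall fun l => ?_)
            rw [norm_mul, norm_pow, Complex.norm_real, Complex.norm_real, norm_norm,
              Real.norm_eq_abs, ← mul_assoc]
            gcongr
            exact hkM l
        _ = M * ∫ l : ℝ, (Real.exp (-l ^ 2) *
          ‖∫ t : ℝ, g t * Complex.exp (Complex.I * (t : ℂ) * (l : ℂ))‖ ^ 2) := integral_const_mul _ _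
        _ ≤ M * (C * I) := by
            gcongr
            exact hG g hg hg2
        _ = _ := by ring
    rcases hI0.eq_or_lt with h0 | h0
    · rw [← h0]; positivity
    · have h4 : I ^ 2 ≤ ‖v‖ ^ 2 * (M * C * I) := by
        calc I ^ 2 ≤ (‖v‖ * ‖y‖) ^ 2 := by gcongr
          _ = ‖v‖ ^ 2 * ‖y‖ ^ 2 := by ring
          _ ≤ _ := by gcongr
      nlinarith
  refine ⟨M * C, by positivity, fun v => ?_⟩
  have hcv : Continuous fun τ : ℝ => ‖⟪v, G.U (-τ) u⟫_ℂ‖ ^ 2 := by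
    have := continuous_U_neg G u
    fun_prop
  have hinteg : Integrable (fun τ : ℝ => ‖⟪v, G.U (-τ) u⟫_ℂ‖ ^ 2) := by
    refine integrable_of_intervalIntegral_norm_bounded (l := atTop) (a := fun n : ℕ => -(n : ℝ))
      (b := fun n : ℕ => (n : ℝ)) (M * C * ‖v‖ ^ 2) (fun n => ?_) ?_ ?_ ?_
    · exact (hcv.integrableOn_Icc).mono_set Ioc_subset_Icc_self
    · exact tendsto_neg_atTop_atBot.comp tendsto_natCast_atTop_atTop
    · exact tendsto_natCast_atTop_atTop
    · refine Eventually.of_forall fun n => ?_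
      simpa using key v n (Nat.cast_nonneg n)
  refine ⟨hinteg, ?_⟩
  refine le_of_tendsto (intervalIntegral_tendsto_integral (l := atTop)
    (a := fun n : ℕ => -(n : ℝ)) (b := fun n : ℕ => (n : ℝ)) hinteg
    (tendsto_neg_atTop_atBot.comp tendsto_natCast_atTop_atTop) tendsto_natCast_atTop_atTop)
    (Eventually.of_forall fun n => key v n (Nat.cast_nonneg n))

end
end KKB

namespace KKB
section
open scoped ComplexConjugate

theorem four_uniq_real (μ : Measure ℝ) [IsFiniteMeasure μ] (f : ℝ → ℝ) (hf : Integrable f μ)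
    (h0 : ∀ t : ℝ, ∫ l, Complex.exp (t * l * I) * (f l : ℂ) ∂μ = 0) : f =ᵐ[μ] 0 := by
  have := isFiniteMeasure_withDensity_ofReal hf.2
  have hfn : Integrable (fun l => - f l) μ := hf.neg
  have key : ∀ (g : ℝ → ℝ), Integrable g μ → ∀ t : ℝ,
      charFun (μ.withDensity (fun l => ENNReal.ofReal (g l))) t
       = ∫ l, Complex.exp (t * l * I) * ((max (g l) 0 : ℝ) : ℂ) ∂μ := by
    intro g hg t
    rw [charFun_apply_real, integral_withDensity_eq_integral_toReal_smul₀
      hg.aestronglyMeasurable.aemeasurable.ennreal_ofReal (by simp)]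
    refine integral_congr_ae (Eventually.of_forall fun l => ?_)
    simp [ENNReal.toReal_ofReal', mul_comm]
  have hinteg : ∀ (g : ℝ → ℝ), Integrable g μ → ∀ t : ℝ,
      Integrable (fun l : ℝ => Complex.exp (t * l * I) * ((max (g l) 0 : ℝ) : ℂ)) μ := by
    intro g hg t
    refine Integrable.bdd_mul (c := 1) hg.pos_part.ofReal (by fun_prop) (Eventually.of_forall fun l => ?_)
    rw [← ofReal_mul, Complex.norm_exp_ofReal_mul_I]
  have he : μ.withDensity (fun l => ENNReal.ofReal (f l)) = μ.withDensity (fun l => ENNReal.ofReal (-f l)) := by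
    have : IsFiniteMeasure (μ.withDensity (fun l => ENNReal.ofReal (-f l))) := 
      isFiniteMeasure_withDensity_ofReal hfn.2
    apply Measure.ext_of_charFun
    ext t
    rw [key f hf, key (fun l => - f l) hfn, ← sub_eq_zero, ← integral_sub (hinteg f hf t) (hinteg _ hfn t), ← h0 t]
    refine integral_congr_ae (Eventually.of_forall fun l => ?_)
    simp only [← mul_sub, ← ofReal_sub]
    congr 2
    rcases le_total (f l) 0 with h | h
    · rw [max_eq_right h, max_eq_left (by linarith)]; ring
    · rw [max_eq_left h, max_eq_right (by linarith)]; ring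
  rw [withDensity_eq_iff_of_sigmaFinite hf.aestronglyMeasurable.aemeasurable.ennreal_ofReal
    hfn.aestronglyMeasurable.aemeasurable.ennreal_ofReal] at he
  filter_upwards [he] with l hl
  have := congrArg ENNReal.toReal hl
  simp only [ENNReal.toReal_ofReal'] at this
  rcases le_total (f l) 0 with h | h
  · rw [max_eq_right h, max_eq_left (by linarith)] at this; simp; linarith
  · rw [max_eq_left h, max_eq_right (by linarith)] at this; simp; linarith

theorem four_uniq (μ : Measure ℝ) [IsFiniteMeasure μ] (f : ℝ → ℂ) (hf : Integrable f μ)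
    (h0 : ∀ t : ℝ, ∫ l, Complex.exp (t * l * I) * f l ∂μ = 0) : f =ᵐ[μ] 0 := by
  have hinteg : ∀ (g : ℝ → ℂ), Integrable g μ → ∀ t : ℝ,
      Integrable (fun l : ℝ => Complex.exp (t * l * I) * g l) μ := by
    intro g hg t
    refine Integrable.bdd_mul (c := 1) hg (by fun_prop) (Eventually.of_forall fun l => ?_)
    rw [← ofReal_mul, Complex.norm_exp_ofReal_mul_I]
  have hc : Integrable (fun l => conj (f l)) μ := 
    (LinearIsometryEquiv.integrable_comp_iff (conjLIE)).2 hf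
  have h1 : ∀ t : ℝ, ∫ l, Complex.exp (t * l * I) * conj (f l) ∂μ = 0 := by
    intro t
    have := congrArg conj (h0 (-t))
    rw [← integral_conj] at this
    rw [map_zero] at this
    rw [← this]
    refine integral_congr_ae (Eventually.of_forall fun l => ?_)
    simp [← Complex.exp_conj]
  have hre : (fun l => (f l).re) =ᵐ[μ] 0 := by
    refine four_uniq_real μ _ hf.re fun t => ?_
    have : ∀ l : ℝ, Complex.exp (t * l * I) * (((f l).re : ℝ) : ℂ) =
      (1/2) * (Complex.exp (t * l * I) * f l + Complex.exp (t * l * I) * conj (f l)) := by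
      intro l
      rw [Complex.re_eq_add_conj]; ring
    simp only [this]
    rw [integral_const_mul, integral_add (hinteg _ hf t) (hinteg _ hc t), h0, h1]; simp
  have him : (fun l => (f l).im) =ᵐ[μ] 0 := by
    refine four_uniq_real μ _ hf.im fun t => ?_
    have : ∀ l : ℝ, Complex.exp (t * l * I) * (((f l).im : ℝ) : ℂ) =
      (1/(2*I)) * (Complex.exp (t * l * I) * f l - Complex.exp (t * l * I) * conj (f l)) := by
      intro l
      rw [Complex.im_eq_sub_conj]; ring
    simp only [this]
    rw [integral_const_mul, integral_sub (hinteg _ hf t) (hinteg _ hc t), h0, h1]; simp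
  filter_upwards [hre, him] with l h1 h2
  exact Complex.ext h1 h2

variable (μ : Measure ℝ) [IsFiniteMeasure μ]

theorem memLp_bdd {g : ℝ → ℂ} (hg : Measurable g) (hb : ∀ l, ‖g l‖ ≤ 1) : MemLp g 2 μ :=
  MemLp.of_bound hg.aestronglyMeasurable 1 (Eventually.of_forall hb)

/-- class of a bounded measurable function -/
def T {g : ℝ → ℂ} (hg : Measurable g) (hb : ∀ l, ‖g l‖ ≤ 1) : Lp ℂ 2 μ := (memLp_bdd μ hg hb).toLp g

theorem T_coe {g : ℝ → ℂ} (hg : Measurable g) (hb : ∀ l, ‖g l‖ ≤ 1) : T μ hg hb =ᵐ[μ] g :=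
  MemLp.coeFn_toLp _

theorem inner_T {g k : ℝ → ℂ} (hg : Measurable g) (hb : ∀ l, ‖g l‖ ≤ 1) (hk : Measurable k)
    (hkb : ∀ l, ‖k l‖ ≤ 1) : ⟪T μ hg hb, T μ hk hkb⟫_ℂ = ∫ l, conj (g l) * k l ∂μ := by
  rw [L2.inner_def]
  refine integral_congr_ae ?_
  filter_upwards [T_coe μ hg hb, T_coe μ hk hkb] with l h1 h2
  rw [h1, h2]; simp [mul_comm]

theorem memLp_mul {g : ℝ → ℂ} (hg : Measurable g) (hb : ∀ l, ‖g l‖ ≤ 1) (f : Lp ℂ 2 μ) :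
    MemLp (fun l => g l * f l) 2 μ := by
  refine MemLp.of_le (Lp.memLp f) (hg.aestronglyMeasurable.mul (Lp.aestronglyMeasurable f)) (Eventually.of_forall fun l => ?_)
  rw [norm_mul]
  exact mul_le_of_le_one_left (norm_nonneg _) (hb l)

/-- multiplication operator -/
def Mul {g : ℝ → ℂ} (hg : Measurable g) (hb : ∀ l, ‖g l‖ ≤ 1) : Lp ℂ 2 μ →ₗ[ℂ] Lp ℂ 2 μ where
  toFun f := (memLp_mul μ hg hb f).toLp _
  map_add' f k := by
    rw [← MemLp.toLp_add]
    refine MemLp.toLp_congr _ _ ?_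
    filter_upwards [Lp.coeFn_add f k] with l hl
    simp only [hl, Pi.add_apply, mul_add]
  map_smul' c f := by
    rw [RingHom.id_apply, ← MemLp.toLp_const_smul]
    refine MemLp.toLp_congr _ _ ?_
    filter_upwards [Lp.coeFn_smul c f] with l hl
    simp [hl]; ring

theorem Mul_norm {g : ℝ → ℂ} (hg : Measurable g) (hb : ∀ l, ‖g l‖ ≤ 1) (f : Lp ℂ 2 μ) :
    ‖Mul μ hg hb f‖ ≤ ‖f‖ := by
  refine Lp.norm_le_norm_of_ae_le ?_
  have : Mul μ hg hb f =ᵐ[μ] fun l => g l * f l := MemLp.coeFn_toLp (memLp_mul μ hg hb f)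
  filter_upwards [this] with l hl
  rw [hl, norm_mul]
  exact mul_le_of_le_one_left (norm_nonneg _) (hb l)

theorem Mul_T {g k : ℝ → ℂ} (hg : Measurable g) (hb : ∀ l, ‖g l‖ ≤ 1) (hk : Measurable k)
    (hkb : ∀ l, ‖k l‖ ≤ 1) (hgk : Measurable (fun l => g l * k l)) (hgkb : ∀ l, ‖g l * k l‖ ≤ 1) :
    Mul μ hg hb (T μ hk hkb) = T μ hgk hgkb := by
  refine MemLp.toLp_congr (memLp_mul μ hg hb _) (memLp_bdd μ hgk hgkb) ?_
  filter_upwards [T_coe μ hk hkb] with l hl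
  rw [hl]

theorem em (t : ℝ) : Measurable (fun l : ℝ => Complex.exp (((-(t * l) : ℝ) : ℂ) * I)) := by fun_prop
theorem eb (t : ℝ) : ∀ l : ℝ, ‖Complex.exp (((-(t * l) : ℝ) : ℂ) * I)‖ ≤ 1 := fun l => by
  rw [Complex.norm_exp_ofReal_mul_I]

/-- exponentials -/
def ee (t : ℝ) : Lp ℂ 2 μ := T μ (em t) (eb t)

theorem ee_dense : Dense (Submodule.span ℂ (range (ee μ)) : Set (Lp ℂ 2 μ)) := by
  rw [Submodule.dense_iff_topologicalClosure_eq_top, Submodule.topologicalClosure_eq_top_iff,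
    Submodule.eq_bot_iff]
  intro f hf
  have hz : ∀ t, ⟪ee μ t, f⟫_ℂ = 0 := fun t => 
    (Submodule.mem_orthogonal _ _).1 hf _ (Submodule.subset_span ⟨t, rfl⟩)
  refine (Lp.eq_zero_iff_ae_eq_zero).2 ?_
  refine four_uniq μ _ ((Lp.memLp f).integrable (by norm_num)) fun t => ?_
  rw [← hz t, L2.inner_def]
  refine integral_congr_ae ?_
  filter_upwards [T_coe μ (em t) (eb t)] with l hl
  unfold ee
  rw [hl]
  simp [← Complex.exp_conj, mul_comm]
end
end KKB

namespace KKB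
section
open scoped ComplexConjugate
variable {H : Type*} [NormedAddCommGroup H] [InnerProductSpace ℂ H] [CompleteSpace H]

/-- sign-type function -/
def sg (h : ℝ → ℝ) (l : ℝ) : ℂ := ((h l / |h l| : ℝ) : ℂ)

theorem sg_meas {h : ℝ → ℝ} (hm : Measurable h) : Measurable (sg h) := by
  unfold sg
  have : Measurable fun l => |h l| := hm.abs
  fun_prop

theorem sg_bdd (h : ℝ → ℝ) (l : ℝ) : ‖sg h l‖ ≤ 1 := by
  unfold sg
  rw [Complex.norm_real, Real.norm_eq_abs, abs_div, abs_abs]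
  exact div_self_le_one _

theorem sg_mul (h : ℝ → ℝ) (l : ℝ) : ((|h l| : ℝ) : ℂ) * sg h l = h l := by
  unfold sg
  rw [← ofReal_mul]
  congr 1
  by_cases h0 : h l = 0
  · simp [h0]
  · field_simp

theorem norm_mul_le_one {a b : ℂ} (ha : ‖a‖ ≤ 1) (hb : ‖b‖ ≤ 1) : ‖a * b‖ ≤ 1 := by
  rw [norm_mul]; exact mul_le_one₀ ha (norm_nonneg _) hb

theorem density_meas (G : SelfAdjointDynamics H) (x : H) (h : ℝ → ℝ) (hm : Measurable h)
    (hi : Integrable h)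
    (hx : ∀ t : ℝ, ⟪G.U t x, x⟫_ℂ = ∫ l : ℝ, Complex.exp (I * t * l) * (h l : ℂ))
    (ε : ℝ) (hε : 0 < ε) : ∃ u, ‖x - u‖ < ε ∧ Nice G u := by
  have habs : Measurable fun l => |h l| := hm.abs
  set μ : Measure ℝ := volume.withDensity (fun l => ENNReal.ofReal |h l|) with hμ
  have hμf : IsFiniteMeasure μ := isFiniteMeasure_withDensity_ofReal hi.abs.2
  have hconv : ∀ g : ℝ → ℂ, ∫ l, g l ∂μ = ∫ l, ((|h l| : ℝ) : ℂ) * g l := by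
    intro g
    rw [hμ, integral_withDensity_eq_integral_toReal_smul habs.ennreal_ofReal (by simp)]
    refine integral_congr_ae (Eventually.of_forall fun l => ?_)
    simp [ENNReal.toReal_ofReal (abs_nonneg _)]
  have hconv' : ∀ g k : ℝ → ℂ, (∀ l, g l = sg h l * k l) → ∫ l, g l ∂μ = ∫ l, k l * (h l : ℂ) := by
    intro g k hgk
    rw [hconv]
    refine integral_congr_ae (Eventually.of_forall fun l => ?_)
    simp only [hgk]
    rw [← sg_mul h l]; ring
  have csg : ∀ l, conj (sg h l) = sg h l := fun l => by unfold sg; rw [Complex.conj_ofReal]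
  -- the functions
  have wm : ∀ s : ℝ, Measurable fun l : ℝ => sg h l * Complex.exp (((-(s * l) : ℝ) : ℂ) * I) :=
    fun s => (sg_meas hm).mul (em s)
  have wb : ∀ s : ℝ, ∀ l : ℝ, ‖sg h l * Complex.exp (((-(s * l) : ℝ) : ℂ) * I)‖ ≤ 1 :=
    fun s l => norm_mul_le_one (sg_bdd h l) (eb s l)
  let w : ℝ → Lp ℂ 2 μ := fun s => T μ (wm s) (wb s)
  have hMw : ∀ s, Mul μ (sg_meas hm) (sg_bdd h) (ee μ s) = w s := fun s => 
    Mul_T μ (sg_meas hm) (sg_bdd h) (em s) (eb s) (wm s) (wb s)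
  have hUU : ∀ s t : ℝ, ⟪G.U s x, G.U t x⟫_ℂ = ⟪w s, ee μ t⟫_ℂ := by
    intro s t
    have : ⟪G.U s x, G.U t x⟫_ℂ = ⟪G.U (s + -t) x, x⟫_ℂ := by
      rw [U_add_apply, inner_U_left _ (-t), neg_neg]
    rw [this, hx]
    simp only [w, ee]
    rw [inner_T, hconv' _ (fun l : ℝ => Complex.exp (I * ((s + -t : ℝ) : ℂ) * l))]
    intro l
    rw [map_mul, csg, ← Complex.exp_conj, mul_assoc, ← Complex.exp_add]
    congr 2
    simp; ring
  let Φ : (ℝ →₀ ℂ) →ₗ[ℂ] Lp ℂ 2 μ := Finsupp.linearCombination ℂ (ee μ)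
  let Ψ : (ℝ →₀ ℂ) →ₗ[ℂ] H := Finsupp.linearCombination ℂ (fun t => G.U t x)
  have hΦd : DenseRange Φ := by
    have := ee_dense μ
    rw [← Finsupp.range_linearCombination] at this
    exact this
  have hΨΦ : ∀ c d, ⟪Ψ c, Ψ d⟫_ℂ = ⟪Mul μ (sg_meas hm) (sg_bdd h) (Φ c), Φ d⟫_ℂ := by
    intro c d
    simp only [Ψ, Φ, Finsupp.linearCombination_apply, Finsupp.sum, map_sum, map_smul, hMw,
      sum_inner, inner_sum, inner_smul_left, inner_smul_right, hUU]
  have hbd : ∀ c, ‖Ψ c‖ ≤ 1 * ‖Φ c‖ := by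
    intro c
    rw [one_mul]
    have h1 : ‖Ψ c‖ ^ 2 ≤ ‖Φ c‖ ^ 2 := by
      calc ‖Ψ c‖ ^ 2 = ‖⟪Ψ c, Ψ c⟫_ℂ‖ := by rw [inner_self_eq_norm_sq_to_K]; simp
        _ = ‖⟪Mul μ (sg_meas hm) (sg_bdd h) (Φ c), Φ c⟫_ℂ‖ := by rw [hΨΦ]
        _ ≤ ‖Mul μ (sg_meas hm) (sg_bdd h) (Φ c)‖ * ‖Φ c‖ := norm_inner_le_norm _ _
        _ ≤ ‖Φ c‖ * ‖Φ c‖ := by gcongr; exact Mul_norm _ _ _ _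
        _ = ‖Φ c‖ ^ 2 := by ring
    exact (sq_le_sq₀ (norm_nonneg _) (norm_nonneg _)).1 h1
  let V : Lp ℂ 2 μ →L[ℂ] H := Ψ.extendOfNorm Φ
  have hVe : ∀ t, V (ee μ t) = G.U t x := by
    intro t
    have := LinearMap.extendOfNorm_eq hΦd ⟨1, hbd⟩ (Finsupp.single t 1)
    simpa [Φ, Ψ, V] using this
  have hVn : ∀ f, ‖V f‖ ≤ ‖f‖ := fun f => by
    simpa using LinearMap.norm_extendOfNorm_apply_le hΦd 1 hbd f
  have hUV : ∀ s f, ⟪G.U s x, V f⟫_ℂ = ⟪w s, f⟫_ℂ := by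
    intro s
    have : (innerSL ℂ (G.U s x)).comp V = innerSL ℂ (w s) := by
      refine ContinuousLinearMap.ext_on (ee_dense μ) ?_
      rintro _ ⟨t, rfl⟩
      simp [hVe, hUU]
    intro f
    exact DFunLike.congr_fun this f
  -- cutoffs
  let E : ℕ → Set ℝ := fun n => {l | |h l| ≤ n * Real.exp (-l ^ 2)}
  have hE : ∀ n, MeasurableSet (E n) := fun n => measurableSet_le habs (by fun_prop)
  have im : ∀ n, Measurable (fun l => (E n).indicator (1 : ℝ → ℂ) l) := fun n => 
    measurable_one.indicator (hE n)
  have ib : ∀ n, ∀ l, ‖(E n).indicator (1 : ℝ → ℂ) l‖ ≤ 1 := fun n l => by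
    by_cases hl : l ∈ E n <;> simp [hl]
  let u : ℕ → H := fun n => V (T μ (im n) (ib n))
  have hnice : ∀ n, Nice G (u n) := by
    intro n
    refine nice_of_density G (u n) ((E n).indicator h) 
      (hm.indicator (hE n)).aestronglyMeasurable n n.cast_nonneg ?_ ?_
    · intro l
      by_cases hl : l ∈ E n
      · rw [indicator_of_mem hl]; exact hl
      · rw [indicator_of_notMem hl, abs_zero]; positivity
    · intro t
      have xm : Measurable fun l : ℝ => (E n).indicator (1 : ℝ → ℂ) l * (sg h l * Complex.exp (((-((-t) * l) : ℝ) : ℂ) * I)) :=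
        (im n).mul (wm _)
      have xb : ∀ l : ℝ, ‖(E n).indicator (1 : ℝ → ℂ) l * (sg h l * Complex.exp (((-((-t) * l) : ℝ) : ℂ) * I))‖ ≤ 1 :=
        fun l => norm_mul_le_one (ib n l) (wb _ l)
      have hV : ∀ f, ⟪u n, G.U t (V f)⟫_ℂ = ⟪T μ xm xb, f⟫_ℂ := by
        have : (innerSL ℂ (u n)).comp ((G.U t).toContinuousLinearEquiv.toContinuousLinearMap.comp V) = innerSL ℂ (T μ xm xb) := by
          refine ContinuousLinearMap.ext_on (ee_dense μ) ?_
          rintro _ ⟨s, rfl⟩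
          have e1 : ⟪u n, G.U t (G.U s x)⟫_ℂ = ⟪T μ xm xb, ee μ s⟫_ℂ := by
            rw [← U_add_apply, ← inner_conj_symm, hUV, inner_conj_symm]
            simp only [w, ee]
            rw [inner_T, inner_T]
            refine integral_congr_ae (Eventually.of_forall fun l => ?_)
            simp only [map_mul, csg]
            have : Complex.exp (((-((s + t) * l) : ℝ) : ℂ) * I) = 
              conj (Complex.exp (((-((-t) * l) : ℝ) : ℂ) * I)) * Complex.exp (((-(s * l) : ℝ) : ℂ) * I) := by
              rw [← Complex.exp_conj, ← Complex.exp_add]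
              congr 1; simp; ring
            rw [this]; ring
          simpa [hVe] using e1
        intro f
        exact DFunLike.congr_fun this f
      rw [← inner_conj_symm]
      conv_lhs => rw [show G.U t (u n) = G.U t (V (T μ (im n) (ib n))) from rfl]
      rw [hV, inner_conj_symm, inner_T, 
        hconv' _ (fun l : ℝ => (E n).indicator (1 : ℝ → ℂ) l * Complex.exp (I * t * l))]
      · refine integral_congr_ae (Eventually.of_forall fun l => ?_)
        by_cases hl : l ∈ E n <;> simp [hl]
      · intro l
        have : Complex.exp (((-((-t) * l) : ℝ) : ℂ) * I) = Complex.exp (I * t * l) := by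
          congr 1; simp; ring
        rw [this]
        by_cases hl : l ∈ E n <;> simp [hl]
  have hnorm : ∀ n, ‖x - u n‖ ^ 2 ≤ μ.real (E n)ᶜ := by
    intro n
    have e0 : x = V (ee μ 0) := by rw [hVe, U_zero_apply]
    have e1 : ‖x - u n‖ ≤ ‖ee μ 0 - T μ (im n) (ib n)‖ := by
      conv_lhs => rw [e0]
      simp only [u]
      rw [← map_sub]; exact hVn _
    have e2 : ‖ee μ 0 - T μ (im n) (ib n)‖ ^ 2 = μ.real (E n)ᶜ := by
      have cm : Measurable (fun l => (E n)ᶜ.indicator (1 : ℝ → ℂ) l) := measurable_one.indicator (hE n).compl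
      have cb : ∀ l, ‖(E n)ᶜ.indicator (1 : ℝ → ℂ) l‖ ≤ 1 := fun l => by
        by_cases hl : l ∈ E n <;> simp [hl]
      have e3 : ee μ 0 - T μ (im n) (ib n) = T μ cm cb := by
        unfold ee T
        rw [← MemLp.toLp_sub]
        refine MemLp.toLp_congr _ _ (Eventually.of_forall fun l => ?_)
        by_cases hl : l ∈ E n <;> simp [hl]
      have e4 : ((‖T μ cm cb‖ ^ 2 : ℝ) : ℂ) = ((μ.real (E n)ᶜ : ℝ) : ℂ) := by
        have := inner_self_eq_norm_sq_to_K (𝕜 := ℂ) (T μ cm cb)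
        rw [inner_T] at this
        push_cast
        refine Eq.trans this.symm ?_
        have h5 : ∀ l, conj ((E n)ᶜ.indicator (1 : ℝ → ℂ) l) * (E n)ᶜ.indicator (1 : ℝ → ℂ) l = (E n)ᶜ.indicator (1 : ℝ → ℂ) l := by
          intro l
          by_cases hl : l ∈ E n <;> simp [hl]
        simp only [h5]
        rw [integral_indicator (hE n).compl]
        simp
      rw [e3]; exact_mod_cast e4
    calc _ ≤ _ := pow_le_pow_left₀ (norm_nonneg _) e1 2
      _ = _ := e2
  have hlim : Tendsto (fun n => μ.real (E n)ᶜ) atTop (𝓝 0) := by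
    have := tendsto_measure_iInter_atTop (μ := μ) (s := fun n => (E n)ᶜ) (fun n => (hE n).compl.nullMeasurableSet)
      (by
        intro m n hmn
        apply compl_subset_compl.2
        intro l hl
        simp only [E, mem_ofPred_eq] at hl ⊢
        refine hl.trans ?_
        gcongr) ⟨0, measure_ne_top _ _⟩
    have hem : (⋂ n, (E n)ᶜ) = ∅ := by
      rw [← compl_iUnion, compl_empty_iff, eq_univ_iff_forall]
      intro l
      obtain ⟨n, hn⟩ := exists_nat_ge (|h l| / Real.exp (-l ^ 2))
      refine mem_iUnion.2 ⟨n, ?_⟩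
      exact (div_le_iff₀ (Real.exp_pos _)).1 hn
    rw [hem, measure_empty] at this
    exact (ENNReal.tendsto_toReal ENNReal.zero_ne_top).comp this
  obtain ⟨n, hn⟩ := (hlim.eventually (gt_mem_nhds (show (0:ℝ) < ε ^ 2 by positivity))).exists
  exact ⟨u n, lt_of_pow_lt_pow_left₀ 2 hε.le ((hnorm n).trans_lt hn), hnice n⟩

theorem density (G : SelfAdjointDynamics H) (x : H) (h : ℝ → ℝ) (hi : Integrable h)
    (hx : ∀ t : ℝ, ⟪G.U t x, x⟫_ℂ = ∫ l : ℝ, Complex.exp (I * t * l) * (h l : ℂ))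
    (ε : ℝ) (hε : 0 < ε) : ∃ u, ‖x - u‖ < ε ∧ Nice G u := by
  have hae := hi.aestronglyMeasurable.ae_eq_mk
  refine density_meas G x (hi.aestronglyMeasurable.mk h) 
    hi.aestronglyMeasurable.stronglyMeasurable_mk.measurable (hi.congr hae) (fun t => ?_) ε hε
  rw [hx]
  refine integral_congr_ae ?_
  filter_upwards [hae] with l hl
  rw [← hl]

theorem main (GA GB : SelfAdjointDynamics H)
    (hfin : ∃ (m : ℕ) (v : Fin m → H), ∀ x : H,
      GA.resolvent x - GB.resolvent x ∈ Submodule.span ℂ (Set.range v)) :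
    ∀ u₀ : H, ∃ uplus : H,
      Tendsto (fun t : ℝ => ‖GB.U (-t) (GB.Pac u₀) - GA.U (-t) uplus‖) atTop (𝓝 0) := by
  intro u₀
  obtain ⟨h, hi, hx⟩ := (GB.Pac_mem (GB.Pac u₀)).1 (GB.Pac_idem u₀)
  obtain ⟨n, f, b, hD⟩ := exists_finite_rank (RC GA - RC GB) hfin
  have hS : GB.Pac u₀ ∈ (S GA GB : Set H) := by
    rw [← (S_closed GA GB).closure_eq, Metric.mem_closure_iff]
    intro ε hε
    obtain ⟨u, hu, hn⟩ := density GB _ h hi hx ε hε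
    exact ⟨u, mem_S_of_nice GA GB hn hD, by rwa [dist_eq_norm]⟩
  obtain ⟨z, hz⟩ := hS
  refine ⟨z, ?_⟩
  have := tendsto_iff_norm_sub_tendsto_zero.1 hz
  refine this.congr fun t => ?_
  rw [← (GA.U t).norm_map (GB.U (-t) (GB.Pac u₀) - GA.U (-t) z), map_sub, U_cancel_neg]
  rfl
end
end KKB

/-- Kato–Kuroda–Birman consequence: if `A, B` are self-adjoint and
`(A+i)⁻¹ − (B+i)⁻¹` has finite rank, then for every `u₀` there is `uplus` with
`‖e^{-itB} P_{ac}(B) u₀ − e^{-itA} uplus‖ → 0` as `t → ∞`. -/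
theorem kato_kuroda_birman {H : Type*} [NormedAddCommGroup H]
    [InnerProductSpace ℂ H] [CompleteSpace H]
    (GA GB : SelfAdjointDynamics H)
    (hfin : ∃ (m : ℕ) (v : Fin m → H), ∀ x : H,
      GA.resolvent x - GB.resolvent x ∈ Submodule.span ℂ (Set.range v)) :
    ∀ u₀ : H, ∃ uplus : H,
      Tendsto (fun t : ℝ => ‖GB.U (-t) (GB.Pac u₀) - GA.U (-t) uplus‖) atTop (𝓝 0) := by
  exact KKB.main GA GB hfin
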